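/- Let G = (V,E) be a finite graph with vertex set of size n, and let x₀ ≠ δ be two vertices of V. Let ρ be a probability measure on (0,∞)^E such that each coordinate W_e is ρ-integrable. For W ∈ (0,∞)^E, regard W as the symmetric n×n matrix with entry W_{{x,y}} for {x,y} ∈ E and 0 otherwise, and let ν_n^{W,0} be the associated law of the β-field, with corresponding matrix H_β and inverse G_β = H_β^{-1}. Define the effective weight w_eff(G_β) := G_β(x₀,δ)/(G_β(x₀,x₀)G_β(δ,δ) − G_β(x₀,δ)²). Then ∫_{(0,∞)^E} ∫_{ℝ^n} w_eff(G_β) ν_n^{W,0}(dβ) ρ(dW) ≤ c_eff(c̄), where c̄_e := ∫ W_e ρ(dW) and c_eff is the effective conductance between x₀ and δ for the conductances c̄. -/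

import Mathlib

open scoped Classical

open MeasureTheory Matrix

noncomputable instance matrixMeasurableSpace {m n : Type*} :
    MeasurableSpace (Matrix m n ℝ) :=
  (inferInstance : MeasurableSpace (m → n → ℝ))

noncomputable def Hmat {n : ℕ} (W : Matrix (Fin n) (Fin n) ℝ) (β : Fin n → ℝ) :
    Matrix (Fin n) (Fin n) ℝ :=
  fun i j => if i = j then 2 * β i - W i i else - W i j

noncomputable def nuDensity {n : ℕ} (W : Matrix (Fin n) (Fin n) ℝ) (η : Fin n → ℝ)
    (β : Fin n → ℝ) : ℝ :=
  if (Hmat W β).PosDef then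
    (2 / Real.pi) ^ ((n : ℝ) / 2) *
      Real.exp (-(1/2) * ((∑ i, ∑ j, Hmat W β i j)
        + (η ⬝ᵥ ((Hmat W β)⁻¹ *ᵥ η)) - 2 * ∑ i, η i)) *
      (Real.sqrt (Hmat W β).det)⁻¹
  else 0

/-- The measure ν_n^{W,η} on ℝ^n. -/
noncomputable def nuMeasure {n : ℕ} (W : Matrix (Fin n) (Fin n) ℝ) (η : Fin n → ℝ) :
    Measure (Fin n → ℝ) :=
  volume.withDensity (fun β => ENNReal.ofReal (nuDensity W η β))

/-- The measure ν̃_n^{W,η}: pushforward of ν_n^{W,η} under β ↦ H_β. -/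
noncomputable def nuTilde {n : ℕ} (W : Matrix (Fin n) (Fin n) ℝ) (η : Fin n → ℝ) :
    Measure (Matrix (Fin n) (Fin n) ℝ) :=
  (nuMeasure W η).map (Hmat W)

/-- Indices i and j are H-connected. -/
def HConnected {n : ℕ} (H : Matrix (Fin n) (Fin n) ℝ) (i j : Fin n) : Prop :=
  Relation.ReflTransGen (fun a b => H a b ≠ 0) i j

/-- Effective conductance between x₀ and δ for conductances κ on a finite
graph G (each edge counted once). -/
noncomputable def ceff {V : Type*} [Fintype V] (G : SimpleGraph V)
    [DecidableRel G.Adj] (κ : V → V → ℝ) (x0 δ : V) : ℝ :=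
  sInf ((fun F : V → ℝ =>
    (1 / 2) * ∑ x, ∑ y, if G.Adj x y then κ x y * (F x - F y) ^ 2 else 0) ''
      {F | F x0 = 1 ∧ F δ = 0})

/-- The effective weight between x₀ and δ for the VRJP, in terms of
G_β = H_β⁻¹. -/
noncomputable def weff {n : ℕ} (G : Matrix (Fin n) (Fin n) ℝ) (x0 δ : Fin n) : ℝ :=
  G x0 δ / (G x0 x0 * G δ δ - (G x0 δ) ^ 2)

open scoped ENNReal

theorem lintegral_exp_mul_exp_neg_sinh_sq {s : ℝ} (hs : 0 < s) :
    ∫⁻ y : ℝ, ENNReal.ofReal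
      (√(2 * s / Real.pi) * (Real.exp y * Real.exp (-(2 * s) * Real.sinh y ^ 2))) = 1 := by
  set J := ∫⁻ y : ℝ, ENNReal.ofReal
      (√(2 * s / Real.pi) * (Real.exp y * Real.exp (-(2 * s) * Real.sinh y ^ 2))) with hJ
  have hneg : J = ∫⁻ y : ℝ, ENNReal.ofReal
      (√(2 * s / Real.pi) * (Real.exp (-y) * Real.exp (-(2 * s) * Real.sinh y ^ 2))) := by
    rw [hJ, ← lintegral_neg_eq_self]
    simp
  have hsum : J + J = 2 := by
    nth_rewrite 2 [hneg]
    rw [hJ, ← lintegral_add_left (by fun_prop)]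
    have himage := lintegral_image_eq_lintegral_abs_deriv_mul (s := Set.univ)
      (f := Real.sinh) (f' := Real.cosh) MeasurableSet.univ
      (fun x _ => (Real.hasDerivAt_sinh x).hasDerivWithinAt) Real.sinh_injective.injOn
      (fun v => ENNReal.ofReal (2 * √(2 * s / Real.pi) * Real.exp (-(2 * s) * v ^ 2)))
    rw [Set.image_univ, Real.sinh_surjective.range_eq, setLIntegral_univ, setLIntegral_univ]
      at himage
    calc _ = ∫⁻ y : ℝ, ENNReal.ofReal |Real.cosh y| * ENNReal.ofReal
          (2 * √(2 * s / Real.pi) * Real.exp (-(2 * s) * Real.sinh y ^ 2)) := by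
          refine lintegral_congr fun y => ?_
          rw [← ENNReal.ofReal_add (by positivity) (by positivity),
            ← ENNReal.ofReal_mul (by positivity), abs_of_pos (Real.cosh_pos y), Real.cosh_eq]
          congr 1
          ring
      _ = ENNReal.ofReal (∫ v : ℝ, 2 * √(2 * s / Real.pi) * Real.exp (-(2 * s) * v ^ 2)) := by
          rw [← himage, ofReal_integral_eq_lintegral_ofReal
            ((integrable_exp_neg_mul_sq (by positivity)).const_mul _)
            (Filter.Eventually.of_forall fun v => by positivity)]
      _ = 2 := by
          rw [integral_const_mul, integral_gaussian, mul_assoc,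
            ← Real.sqrt_mul (by positivity)]
          have : 2 * s / Real.pi * (Real.pi / (2 * s)) = 1 := by
            have := Real.pi_pos
            field_simp
          simp [this]
  have : 2 * J = 2 * 1 := by rw [two_mul, hsum, mul_one]
  exact (ENNReal.mul_right_inj (by simp) (by simp)).mp this

/-- The density, in terms of `h = H_β(i,i)`, of the law of a single coordinate of the `β`-field
at a vertex of total weight `s`. -/
noncomputable def vertexKernel (s h : ℝ) : ℝ :=
  if 0 < h then √(2 / Real.pi) * Real.exp (-(h - 2 * s + s ^ 2 / h) / 2) * (√h)⁻¹ else 0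

theorem vertexKernel_nonneg (s h : ℝ) : 0 ≤ vertexKernel s h := by
  unfold vertexKernel
  split_ifs <;> positivity

theorem measurable_vertexKernel (s : ℝ) : Measurable (vertexKernel s) :=
  Measurable.ite measurableSet_Ioi (by fun_prop) measurable_const

theorem vertexKernel_mul_exp {s : ℝ} (hs : 0 < s) (y : ℝ) :
    s * Real.exp (2 * y) * vertexKernel s (s * Real.exp (2 * y)) =
      √(2 * s / Real.pi) * (Real.exp y * Real.exp (-(2 * s) * Real.sinh y ^ 2)) := by
  have he : Real.exp (2 * y) = Real.exp y ^ 2 := by rw [two_mul, Real.exp_add, sq]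
  have hy := Real.exp_pos y
  have hr : √(2 * s / Real.pi) = √(2 / Real.pi) * √s := by
    rw [← Real.sqrt_mul (by positivity)]; congr 1; ring
  have hsq : √s ^ 2 = s := Real.sq_sqrt hs.le
  rw [vertexKernel, if_pos (by positivity), he, Real.sqrt_mul hs.le, Real.sqrt_sq hy.le, hr]
  have harg : -(s * Real.exp y ^ 2 - 2 * s + s ^ 2 / (s * Real.exp y ^ 2)) / 2 =
      -(2 * s) * Real.sinh y ^ 2 := by
    rw [Real.sinh_eq, Real.exp_neg]
    field_simp
    ring
  rw [harg]
  have : 0 < √s := Real.sqrt_pos.mpr hs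
  field_simp
  rw [hsq]

theorem lintegral_eq_lintegral_exp {s : ℝ} (hs : 0 < s) (c : ℝ) (f : ℝ → ℝ≥0∞)
    (hf : ∀ h ≤ 0, f h = 0) :
    ∫⁻ t : ℝ, f (2 * t - c) =
      ∫⁻ y : ℝ, ENNReal.ofReal (s * Real.exp (2 * y)) * f (s * Real.exp (2 * y)) := by
  have hinj : Function.Injective fun y : ℝ => (s * Real.exp (2 * y) + c) / 2 := by
    intro a b hab
    have : Real.exp (2 * a) = Real.exp (2 * b) := by
      have := hs.ne'
      field_simp at hab
      simpa [this] using hab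
    simpa using Real.exp_injective this
  have hderiv (y : ℝ) : HasDerivAt (fun y : ℝ => (s * Real.exp (2 * y) + c) / 2)
      (s * Real.exp (2 * y)) y := by
    have := (((((hasDerivAt_id y).const_mul 2).exp).const_mul s).add_const c).div_const 2
    refine this.congr_deriv ?_
    simp
    ring
  have hrange : Set.range (fun y : ℝ => (s * Real.exp (2 * y) + c) / 2) = Set.Ioi (c / 2) := by
    ext t
    simp only [Set.mem_range, Set.mem_Ioi]
    constructor
    · rintro ⟨y, rfl⟩
      have : 0 < s * Real.exp (2 * y) := by positivity
      linarith
    · intro ht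
      have : 0 < (2 * t - c) / s := div_pos (by linarith) hs
      refine ⟨Real.log ((2 * t - c) / s) / 2, ?_⟩
      rw [mul_div_cancel₀ _ two_ne_zero, Real.exp_log this]
      field_simp
      ring
  have himage := lintegral_image_eq_lintegral_abs_deriv_mul (s := Set.univ) MeasurableSet.univ
    (fun y _ => (hderiv y).hasDerivWithinAt) hinj.injOn (fun t => f (2 * t - c))
  rw [Set.image_univ, hrange, setLIntegral_univ, ← lintegral_indicator measurableSet_Ioi]
    at himage
  rw [show (∫⁻ t : ℝ, f (2 * t - c)) =
    ∫⁻ t, (Set.Ioi (c / 2)).indicator (fun t => f (2 * t - c)) t from ?_, himage]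
  · refine lintegral_congr fun y => ?_
    rw [abs_of_pos (by positivity)]
    congr 2
    ring
  · refine lintegral_congr fun t => ?_
    by_cases ht : t ∈ Set.Ioi (c / 2)
    · rw [Set.indicator_of_mem ht]
    · rw [Set.indicator_of_notMem ht, hf]
      simp only [Set.mem_Ioi] at ht
      linarith

theorem vertexKernel_of_nonpos (s : ℝ) {h : ℝ} (hh : h ≤ 0) : vertexKernel s h = 0 :=
  if_neg hh.not_gt

theorem lintegral_vertexKernel_zero (c : ℝ) :
    ∫⁻ t : ℝ, ENNReal.ofReal (vertexKernel 0 (2 * t - c)) = 1 := by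
  have hgamma := ProbabilityTheory.lintegral_gammaPDF_eq_one (a := 1 / 2) (r := 1)
    (by norm_num) one_pos
  rw [← hgamma, ← lintegral_sub_right_eq_self (ProbabilityTheory.gammaPDF _ _) (c / 2)]
  refine lintegral_congr_ae ?_
  have hne : ∀ᵐ t : ℝ, t ≠ c / 2 := by simp [ae_iff]
  filter_upwards [hne] with t ht
  rw [ProbabilityTheory.gammaPDF, ProbabilityTheory.gammaPDFReal, vertexKernel]
  congr 1
  rcases lt_or_gt_of_ne ht with h | h
  · rw [if_neg (by linarith), if_neg (by linarith)]
  · have hu : 0 < t - c / 2 := by linarith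
    rw [if_pos (by linarith), if_pos hu.le, Real.Gamma_one_half_eq,
      show 2 * t - c = 2 * (t - c / 2) by ring, Real.sqrt_mul zero_le_two,
      Real.sqrt_div zero_le_two, show (1 / 2 - 1 : ℝ) = -(1 / 2) by norm_num,
      Real.rpow_neg hu.le, ← Real.sqrt_eq_rpow, ← Real.sqrt_eq_rpow, Real.sqrt_one]
    have harg : -(2 * (t - c / 2) - 2 * 0 + 0 ^ 2 / (2 * (t - c / 2))) / 2 =
      -(1 * (t - c / 2)) := by ring
    rw [harg]
    have := Real.sqrt_pos.mpr hu
    have := Real.sqrt_pos.mpr Real.pi_pos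
    field_simp

theorem lintegral_vertexKernel {s : ℝ} (hs : 0 ≤ s) (c : ℝ) :
    ∫⁻ t : ℝ, ENNReal.ofReal (vertexKernel s (2 * t - c)) = 1 := by
  rcases hs.eq_or_lt with rfl | hs
  · exact lintegral_vertexKernel_zero c
  rw [lintegral_eq_lintegral_exp hs c (fun h => ENNReal.ofReal (vertexKernel s h))
    fun h hh => by simp [vertexKernel_of_nonpos s hh], ← lintegral_exp_mul_exp_neg_sinh_sq hs]
  refine lintegral_congr fun y => ?_
  rw [← ENNReal.ofReal_mul (by positivity), vertexKernel_mul_exp hs]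

theorem lintegral_vertexKernel_mul_div_le {s : ℝ} (hs : 0 ≤ s) (c : ℝ) :
    ∫⁻ t : ℝ, ENNReal.ofReal (vertexKernel s (2 * t - c) * (s / (2 * t - c))) ≤ 1 := by
  rcases hs.eq_or_lt with rfl | hs
  · simp
  rw [lintegral_eq_lintegral_exp hs c (fun h => ENNReal.ofReal (vertexKernel s h * (s / h)))
    fun h hh => by simp [vertexKernel_of_nonpos s hh], ← lintegral_exp_mul_exp_neg_sinh_sq hs,
    ← lintegral_neg_eq_self]
  refine (lintegral_congr fun y => ?_).le
  rw [← ENNReal.ofReal_mul (by positivity), ← mul_assoc, mul_neg,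
    ← mul_neg 2 y, vertexKernel_mul_exp hs]
  congr 1
  rw [mul_assoc, mul_assoc]
  congr 1
  rw [mul_neg, Real.exp_neg (2 * y), two_mul y, Real.exp_add, Real.exp_neg y]
  have := Real.exp_pos y
  simp only [Real.sinh_neg, neg_sq]
  field_simp

/-- The Schur complement of a symmetric matrix with respect to the diagonal entry at `p`. -/
noncomputable def schurCompl {n : ℕ} (H : Matrix (Fin (n + 1)) (Fin (n + 1)) ℝ)
    (p : Fin (n + 1)) : Matrix (Fin n) (Fin n) ℝ :=
  fun j k => H (p.succAbove j) (p.succAbove k) -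
    H p (p.succAbove j) * H p (p.succAbove k) / H p p

section SchurComplement

variable {n : ℕ} {H : Matrix (Fin (n + 1)) (Fin (n + 1)) ℝ}

theorem Matrix.PosDef.schurCompl (hH : H.PosDef) (p : Fin (n + 1)) :
    (schurCompl H p).PosDef := by
  have hp : 0 < H p p := hH.diag_pos
  have hsymm (i j) : H i j = H j i := by simpa using hH.isHermitian.apply j i
  refine PosDef.of_dotProduct_mulVec_pos ?_ fun x hx => ?_
  · ext j k
    simp only [conjTranspose_apply, star_trivial, _root_.schurCompl]
    rw [hsymm, mul_comm]
  set z := (∑ j, H p (p.succAbove j) * x j) with hz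
  have hpos := hH.dotProduct_mulVec_pos (x := p.insertNth (-z / H p p) x) (by
    contrapose! hx
    ext j
    simpa using congrFun hx (p.succAbove j))
  refine hpos.trans_eq ?_
  simp only [dotProduct, mulVec, Fin.sum_univ_succAbove _ p, star_trivial, Pi.star_apply,
    Fin.insertNth_apply_same, Fin.insertNth_apply_succAbove, _root_.schurCompl, ← hz]
  have h1 : ∀ j, ∑ k, (H (p.succAbove j) (p.succAbove k) -
      H p (p.succAbove j) * H p (p.succAbove k) / H p p) * x k =
      ∑ k, H (p.succAbove j) (p.succAbove k) * x k - H p (p.succAbove j) * z / H p p := by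
    intro j
    rw [hz, Finset.mul_sum, Finset.sum_div, ← Finset.sum_sub_distrib]
    exact Finset.sum_congr rfl fun k _ => by ring
  have h2 : ∑ j, x j * (H p (p.succAbove j) * z / H p p) = z * z / H p p := by
    conv_rhs => rw [hz, Finset.sum_mul, Finset.sum_div]
    exact Finset.sum_congr rfl fun k _ => by ring
  have h3 : ∑ j, x j * (H (p.succAbove j) p * (-z / H p p)) = -(z * z / H p p) := by
    rw [← h2, ← Finset.sum_neg_distrib (f := fun j => x j * (H p (p.succAbove j) * z / H p p))]
    exact Finset.sum_congr rfl fun j _ => by rw [hsymm _ p]; ring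
  simp only [h1, mul_sub, mul_add, Finset.sum_sub_distrib, Finset.sum_add_distrib, h2, h3]
  field_simp
  ring

theorem det_eq_mul_det_schurCompl (hH : H.IsSymm) {p : Fin (n + 1)} (hp : H p p ≠ 0) :
    H.det = H p p * (schurCompl H p).det := by
  set B : Matrix (Fin (n + 1)) (Fin (n + 1)) ℝ := fun i j =>
    if i = p then H p j else H i j - H i p / H p p * H p j with hB
  have hdet : H.det = B.det := by
    refine det_eq_of_forall_row_eq_smul_add_const
      (fun i => if i = p then 0 else H i p / H p p) p (by simp) fun i j => ?_
    by_cases hi : i = p <;> simp [hB, hi]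
  rw [hdet, det_succ_column B p, Fin.sum_univ_succAbove _ p, Finset.sum_eq_zero, add_zero]
  · have hsub : B.submatrix p.succAbove p.succAbove = schurCompl H p := by
      ext j k
      refine (if_neg (Fin.succAbove_ne p j)).trans ?_
      rw [schurCompl, hH.apply p (p.succAbove j)]
      ring
    have hsign : ((-1 : ℝ)) ^ ((p : ℕ) + p) = 1 := Even.neg_one_pow ⟨p, rfl⟩
    rw [hsub, hsign]
    simp [hB]
  · intro j _
    simp [hB, Fin.succAbove_ne, hp]

theorem inv_submatrix_succAbove (hH : H.PosDef) (p : Fin (n + 1)) :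
    H⁻¹.submatrix p.succAbove p.succAbove = (schurCompl H p)⁻¹ := by
  have hp : H p p ≠ 0 := hH.diag_pos.ne'
  have hsymm (i j) : H i j = H j i := by simpa using hH.isHermitian.apply j i
  have hmul : H * H⁻¹ = 1 := mul_nonsing_inv _ hH.det_pos.ne'.isUnit
  symm
  refine inv_eq_right_inv ?_
  ext i k
  have h1 := congrFun₂ hmul (p.succAbove i) (p.succAbove k)
  have h2 := congrFun₂ hmul p (p.succAbove k)
  rw [mul_apply, Fin.sum_univ_succAbove _ p] at h1 h2
  rw [one_apply_ne (Fin.succAbove_ne p k).symm] at h2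
  have h3 : (1 : Matrix (Fin (n + 1)) (Fin (n + 1)) ℝ) (p.succAbove i) (p.succAbove k) =
      (1 : Matrix (Fin n) (Fin n) ℝ) i k := by
    simp [one_apply]
  rw [h3] at h1
  rw [← h1, mul_apply]
  have h4 : ∑ j, schurCompl H p i j * H⁻¹.submatrix p.succAbove p.succAbove j k =
      ∑ j, H (p.succAbove i) (p.succAbove j) * H⁻¹ (p.succAbove j) (p.succAbove k) -
      H p (p.succAbove i) / H p p *
        ∑ j, H p (p.succAbove j) * H⁻¹ (p.succAbove j) (p.succAbove k) := by
    rw [Finset.mul_sum, ← Finset.sum_sub_distrib]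
    refine Finset.sum_congr rfl fun j _ => ?_
    simp only [schurCompl, submatrix_apply]
    ring
  rw [h4, eq_neg_of_add_eq_zero_right h2, hsymm (p.succAbove i) p]
  field_simp
  ring

theorem sum_sum_eq_schurCompl (hH : H.IsSymm) (p : Fin (n + 1)) :
    ∑ i, ∑ j, H i j = H p p + 2 * ∑ j, H p (p.succAbove j) +
      (∑ j, H p (p.succAbove j)) ^ 2 / H p p + ∑ j, ∑ k, schurCompl H p j k := by
  have h1 : ∑ j, H (p.succAbove j) p = ∑ j, H p (p.succAbove j) :=
    Finset.sum_congr rfl fun j _ => hH.apply _ _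
  have h2 : ∑ j, ∑ k, H p (p.succAbove j) * H p (p.succAbove k) / H p p =
      (∑ j, H p (p.succAbove j)) ^ 2 / H p p := by
    simp only [sq, Finset.sum_mul_sum, Finset.sum_div]
  simp only [Fin.sum_univ_succAbove _ p, Finset.sum_add_distrib, h1, schurCompl,
    Finset.sum_sub_distrib, h2]
  ring

end SchurComplement

/-- The weights obtained from `W` by eliminating the vertex `p`, when the diagonal entry of the
associated matrix `H_β` at `p` is `h`. -/
noncomputable def starMesh {n : ℕ} (W : Matrix (Fin (n + 1)) (Fin (n + 1)) ℝ)
    (p : Fin (n + 1)) (h : ℝ) : Matrix (Fin n) (Fin n) ℝ :=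
  fun j k => W (p.succAbove j) (p.succAbove k) +
    W p (p.succAbove j) * W p (p.succAbove k) / h

theorem Hmat_isSymm {n : ℕ} {W : Matrix (Fin n) (Fin n) ℝ} (hW : W.IsSymm) (β : Fin n → ℝ) :
    (Hmat W β).IsSymm := by
  ext i j
  by_cases h : i = j
  · simp [h]
  · simp [Hmat, h, Ne.symm h, hW.apply i j]

section Elimination

variable {n : ℕ} {W : Matrix (Fin (n + 1)) (Fin (n + 1)) ℝ}

theorem starMesh_isSymm (hW : W.IsSymm) (p : Fin (n + 1)) (h : ℝ) :
    (starMesh W p h).IsSymm := by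
  ext j k
  simp only [transpose_apply, starMesh]
  rw [hW.apply, mul_comm]

theorem starMesh_nonneg (hW : ∀ i j, 0 ≤ W i j) (p : Fin (n + 1)) {h : ℝ} (hh : 0 ≤ h)
    (j k : Fin n) : 0 ≤ starMesh W p h j k :=
  add_nonneg (hW _ _) (div_nonneg (mul_nonneg (hW _ _) (hW _ _)) hh)

theorem Hmat_insertNth_self (W : Matrix (Fin (n + 1)) (Fin (n + 1)) ℝ) (p : Fin (n + 1))
    (t : ℝ) (b : Fin n → ℝ) : Hmat W (p.insertNth t b) p p = 2 * t - W p p := by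
  simp [Hmat]

theorem Hmat_succAbove (W : Matrix (Fin (n + 1)) (Fin (n + 1)) ℝ) (p : Fin (n + 1))
    (β : Fin (n + 1) → ℝ) (j : Fin n) :
    Hmat W β p (p.succAbove j) = -W p (p.succAbove j) := by
  simp [Hmat, (Fin.succAbove_ne p j).symm]

theorem schurCompl_Hmat (W : Matrix (Fin (n + 1)) (Fin (n + 1)) ℝ) (p : Fin (n + 1))
    (t : ℝ) (b : Fin n → ℝ) :
    schurCompl (Hmat W (p.insertNth t b)) p = Hmat (starMesh W p (2 * t - W p p)) b := by
  ext j k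
  simp only [schurCompl, Hmat_insertNth_self, Hmat_succAbove]
  by_cases h : j = k
  · subst h
    simp [Hmat, starMesh]
    ring
  · simp [Hmat, starMesh, h]
    ring

theorem nuDensity_insertNth (hW : W.IsSymm) (p : Fin (n + 1)) (t : ℝ) (b : Fin n → ℝ)
    (hH : (Hmat W (p.insertNth t b)).PosDef) :
    nuDensity W 0 (p.insertNth t b) =
      vertexKernel (∑ j, W p (p.succAbove j)) (2 * t - W p p) *
        nuDensity (starMesh W p (2 * t - W p p)) 0 b := by
  have hS := hH.schurCompl p
  have hpp : 0 < 2 * t - W p p := by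
    simpa only [Hmat_insertNth_self] using (hH.diag_pos (i := p))
  have hdet := det_eq_mul_det_schurCompl (Hmat_isSymm hW (p.insertNth t b)) hH.diag_pos.ne'
    (p := p)
  have hsum := sum_sum_eq_schurCompl (Hmat_isSymm hW (p.insertNth t b)) p
  simp only [schurCompl_Hmat, Hmat_insertNth_self, Hmat_succAbove, Finset.sum_neg_distrib]
    at hS hdet hsum
  rw [nuDensity, if_pos hH, nuDensity, if_pos hS, vertexKernel, if_pos hpp, hdet, hsum,
    Real.sqrt_mul hpp.le]
  have hpow : (2 / Real.pi) ^ (((n + 1 : ℕ) : ℝ) / 2) =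
      (2 / Real.pi) ^ ((n : ℝ) / 2) * √(2 / Real.pi) := by
    rw [Real.sqrt_eq_rpow, ← Real.rpow_add (by positivity)]
    congr 1
    push_cast
    ring
  rw [hpow]
  simp only [zero_dotProduct, Pi.zero_apply, Finset.sum_const_zero, mul_zero, sub_zero, add_zero]
  set s := ∑ j, W p (p.succAbove j)
  set h := 2 * t - W p p
  set T := ∑ j, ∑ k, Hmat (starMesh W p h) b j k
  have hexp : Real.exp (-(1 / 2) * (h + 2 * -s + (-s) ^ 2 / h + T)) =
      Real.exp (-(h - 2 * s + s ^ 2 / h) / 2) * Real.exp (-(1 / 2) * T) := by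
    rw [← Real.exp_add]
    congr 1
    ring
  rw [hexp, mul_inv]
  ring

theorem lintegral_nuDensity_mul_le (hW : W.IsSymm) (p : Fin (n + 1))
    (f : (Fin (n + 1) → ℝ) → ℝ≥0∞) (g : ℝ → (Fin n → ℝ) → ℝ≥0∞)
    (hfg : ∀ t b, (Hmat W (p.insertNth t b)).PosDef → f (p.insertNth t b) ≤ g t b) :
    ∫⁻ β, ENNReal.ofReal (nuDensity W 0 β) * f β ≤
      ∫⁻ t, ENNReal.ofReal (vertexKernel (∑ j, W p (p.succAbove j)) (2 * t - W p p)) *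
        ∫⁻ b, ENNReal.ofReal (nuDensity (starMesh W p (2 * t - W p p)) 0 b) * g t b := by
  have hmp := (volume_preserving_piFinSuccAbove (fun _ : Fin (n + 1) => ℝ) p).symm
  rw [← hmp.lintegral_comp_emb (MeasurableEquiv.measurableEmbedding _)]
  refine (lintegral_prod_le _).trans (lintegral_mono fun t => ?_)
  rw [← lintegral_const_mul' _ _ ENNReal.ofReal_ne_top]
  refine lintegral_mono fun b => ?_
  change ENNReal.ofReal (nuDensity W 0 (p.insertNth t b)) * f (p.insertNth t b) ≤ _
  by_cases hH : (Hmat W (p.insertNth t b)).PosDef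
  · rw [nuDensity_insertNth hW p t b hH, ENNReal.ofReal_mul (vertexKernel_nonneg _ _),
      mul_assoc]
    gcongr
    exact hfg t b hH
  · simp [nuDensity, hH]

end Elimination

theorem lintegral_nuDensity_le_one {n : ℕ} {W : Matrix (Fin n) (Fin n) ℝ} (hW : W.IsSymm)
    (hnonneg : ∀ i j, 0 ≤ W i j) : ∫⁻ β, ENNReal.ofReal (nuDensity W 0 β) ≤ 1 := by
  induction n with
  | zero =>
    rw [lintegral_unique]
    simp only [nuDensity, volume_pi, Measure.pi_empty_univ]
    split_ifs <;> simp
  | succ n ih =>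
    have := lintegral_nuDensity_mul_le hW 0 (fun _ => 1) (fun _ _ => 1) (fun _ _ _ => le_rfl)
    simp only [mul_one] at this
    have hs : 0 ≤ ∑ j, W 0 (Fin.succAbove 0 j) := Finset.sum_nonneg fun j _ => hnonneg _ _
    refine this.trans ((lintegral_mono fun t => ?_).trans (lintegral_vertexKernel hs (W 0 0)).le)
    rcases le_or_gt (2 * t - W 0 0) 0 with ht | ht
    · simp [vertexKernel_of_nonpos _ ht]
    · exact mul_le_of_le_one_right' (ih (starMesh_isSymm hW 0 _) (starMesh_nonneg hnonneg 0 ht.le))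

/-- The Dirichlet energy of `F` for the symmetric conductances `κ`. -/
noncomputable def dirichletEnergy {n : ℕ} (κ : Matrix (Fin n) (Fin n) ℝ) (F : Fin n → ℝ) : ℝ :=
  1 / 2 * ∑ x, ∑ y, κ x y * (F x - F y) ^ 2

theorem dirichletEnergy_nonneg {n : ℕ} {κ : Matrix (Fin n) (Fin n) ℝ} (hκ : ∀ i j, 0 ≤ κ i j)
    (F : Fin n → ℝ) : 0 ≤ dirichletEnergy κ F :=
  mul_nonneg (by norm_num) (Finset.sum_nonneg fun x _ => Finset.sum_nonneg fun y _ =>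
    mul_nonneg (hκ x y) (sq_nonneg _))

theorem dirichletEnergy_starMesh {n : ℕ} (W : Matrix (Fin (n + 1)) (Fin (n + 1)) ℝ)
    (p : Fin (n + 1)) (h : ℝ) (F : Fin n → ℝ) :
    dirichletEnergy (starMesh W p h) F =
      dirichletEnergy (W.submatrix p.succAbove p.succAbove) F +
        dirichletEnergy (fun j k => W p (p.succAbove j) * W p (p.succAbove k)) F / h := by
  simp only [dirichletEnergy, starMesh, submatrix_apply, add_mul, Finset.sum_add_distrib, mul_add,
    Finset.mul_sum, Finset.sum_div]
  congr 1
  exact Finset.sum_congr rfl fun j _ => Finset.sum_congr rfl fun k _ => by ring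

theorem dirichletEnergy_mul {n : ℕ} (w F : Fin n → ℝ) :
    dirichletEnergy (fun j k => w j * w k) F =
      (∑ j, w j) * (∑ j, w j * F j ^ 2) - (∑ j, w j * F j) ^ 2 := by
  have h (j k) : w j * w k * (F j - F k) ^ 2 =
      w j * F j ^ 2 * w k + w j * (w k * F k ^ 2) - 2 * (w j * F j * (w k * F k)) := by ring
  simp only [dirichletEnergy, h, Finset.sum_add_distrib, Finset.sum_sub_distrib,
    ← Finset.mul_sum, ← Finset.sum_mul]
  ring

theorem dirichletEnergy_starMesh_sum_le {n : ℕ} {W : Matrix (Fin (n + 1)) (Fin (n + 1)) ℝ}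
    (hW : W.IsSymm) (hnonneg : ∀ i j, 0 ≤ W i j) (p : Fin (n + 1)) (F : Fin (n + 1) → ℝ) :
    dirichletEnergy (starMesh W p (∑ j, W p (p.succAbove j))) (F ∘ p.succAbove) ≤
      dirichletEnergy W F := by
  set w : Fin n → ℝ := fun j => W p (p.succAbove j) with hw
  have hstar : dirichletEnergy W F = dirichletEnergy (W.submatrix p.succAbove p.succAbove)
      (F ∘ p.succAbove) + ∑ j, w j * (F (p.succAbove j) - F p) ^ 2 := by
    have h1 (j) : W (p.succAbove j) p * (F (p.succAbove j) - F p) ^ 2 =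
        w j * (F (p.succAbove j) - F p) ^ 2 := by rw [hw, hW.apply]
    have h2 (j) : W p (p.succAbove j) * (F p - F (p.succAbove j)) ^ 2 =
        w j * (F (p.succAbove j) - F p) ^ 2 := by rw [hw]; ring
    simp only [dirichletEnergy, Fin.sum_univ_succAbove _ p, h1, h2, Finset.sum_add_distrib,
      submatrix_apply, Function.comp_apply]
    ring
  rw [dirichletEnergy_starMesh, hstar, dirichletEnergy_mul w]
  gcongr
  have hs : 0 ≤ ∑ j, w j := Finset.sum_nonneg fun j _ => hnonneg _ _
  refine div_le_of_le_mul₀ hs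
    (Finset.sum_nonneg fun j _ => mul_nonneg (hnonneg _ _) (sq_nonneg _)) ?_
  have hexpand : ∑ j, w j * (F (p.succAbove j) - F p) ^ 2 =
      ∑ j, w j * F (p.succAbove j) ^ 2 - 2 * F p * ∑ j, w j * F (p.succAbove j) +
        F p ^ 2 * ∑ j, w j := by
    rw [Finset.mul_sum, Finset.mul_sum, ← Finset.sum_sub_distrib, ← Finset.sum_add_distrib]
    exact Finset.sum_congr rfl fun j _ => by ring
  rw [hexpand]
  simp only [Function.comp_apply]
  nlinarith [sq_nonneg (∑ j, w j * F (p.succAbove j) - F p * ∑ j, w j)]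

theorem weff_inv_fin_two {H : Matrix (Fin 2) (Fin 2) ℝ} (hH : H.IsSymm) (hdet : H.det ≠ 0)
    {i j : Fin 2} (hne : i ≠ j) : weff H⁻¹ i j = -H i j := by
  have h10 : H 1 0 = H 0 1 := hH.apply 0 1
  have hD := det_fin_two H
  rw [h10] at hD
  generalize hd : H.det = D at hdet hD
  have hden : D⁻¹ * H 1 1 * (D⁻¹ * H 0 0) - (D⁻¹ * H 0 1) ^ 2 = D⁻¹ := by
    field_simp
    linear_combination -hD
  have hden' : D⁻¹ * H 0 0 * (D⁻¹ * H 1 1) - (D⁻¹ * H 0 1) ^ 2 = D⁻¹ := by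
    rw [mul_comm (D⁻¹ * H 0 0), hden]
  have hinv : H⁻¹ = !![D⁻¹ * H 1 1, -(D⁻¹ * H 0 1); -(D⁻¹ * H 0 1), D⁻¹ * H 0 0] := by
    rw [inv_def, adjugate_fin_two, Ring.inverse_eq_inv', hd, h10]
    ext i j
    fin_cases i <;> fin_cases j <;> simp
  fin_cases i <;> fin_cases j <;> simp [weff, hinv, hden, hden', h10] at hne ⊢ <;> field_simp

theorem weff_Hmat_fin_two {W : Matrix (Fin 2) (Fin 2) ℝ} (hW : W.IsSymm) {x0 δ : Fin 2}
    (hne : x0 ≠ δ) {β : Fin 2 → ℝ} (hH : (Hmat W β).PosDef) :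
    weff (Hmat W β)⁻¹ x0 δ = W x0 δ := by
  rw [weff_inv_fin_two (Hmat_isSymm hW β) hH.det_pos.ne' hne]
  simp [Hmat, hne]

theorem weff_inv_Hmat_insertNth {n : ℕ} {W : Matrix (Fin (n + 1)) (Fin (n + 1)) ℝ}
    {p : Fin (n + 1)} {t : ℝ} {b : Fin n → ℝ} (hH : (Hmat W (p.insertNth t b)).PosDef)
    (x0 δ : Fin n) :
    weff (Hmat W (p.insertNth t b))⁻¹ (p.succAbove x0) (p.succAbove δ) =
      weff (Hmat (starMesh W p (2 * t - W p p)) b)⁻¹ x0 δ := by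
  rw [← schurCompl_Hmat, ← inv_submatrix_succAbove hH]
  rfl

theorem lintegral_vertexKernel_mul_ofReal_le {s a b : ℝ} (hs : 0 ≤ s) (ha : 0 ≤ a) (hb : 0 ≤ b)
    (hsb : s = 0 → b = 0) (c : ℝ) :
    ∫⁻ t, ENNReal.ofReal (vertexKernel s (2 * t - c)) *
      ENNReal.ofReal (a + b / (2 * t - c)) ≤ ENNReal.ofReal (a + b / s) := by
  have hbs : b = b / s * s := by
    rcases eq_or_ne s 0 with h | h
    · simp [hsb h]
    · field_simp
  calc _ ≤ ∫⁻ t, (ENNReal.ofReal (vertexKernel s (2 * t - c)) * ENNReal.ofReal a +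
        ENNReal.ofReal (b / s) *
          ENNReal.ofReal (vertexKernel s (2 * t - c) * (s / (2 * t - c)))) := by
        refine lintegral_mono fun t => ?_
        grw [ENNReal.ofReal_add_le, mul_add]
        rw [← ENNReal.ofReal_mul (vertexKernel_nonneg _ _) (q := b / (2 * t - c)),
          ← ENNReal.ofReal_mul (div_nonneg hb hs)]
        refine le_of_eq ?_
        congr 2
        nth_rewrite 1 [hbs]
        ring
    _ = (∫⁻ t, ENNReal.ofReal (vertexKernel s (2 * t - c))) * ENNReal.ofReal a +
        ENNReal.ofReal (b / s) *
          ∫⁻ t, ENNReal.ofReal (vertexKernel s (2 * t - c) * (s / (2 * t - c))) := by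
        rw [lintegral_add_left, lintegral_mul_const', lintegral_const_mul']
        · exact ENNReal.ofReal_ne_top
        · exact ENNReal.ofReal_ne_top
        · exact ((measurable_vertexKernel s).comp (by fun_prop)).ennreal_ofReal.mul_const _
    _ ≤ 1 * ENNReal.ofReal a + ENNReal.ofReal (b / s) * 1 := by
        gcongr
        · exact (lintegral_vertexKernel hs c).le
        · exact lintegral_vertexKernel_mul_div_le hs c
    _ = _ := by rw [one_mul, mul_one, ENNReal.ofReal_add ha (div_nonneg hb hs)]

theorem lintegral_weff_le_dirichletEnergy {n : ℕ} {W : Matrix (Fin (n + 2)) (Fin (n + 2)) ℝ}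
    (hW : W.IsSymm) (hnonneg : ∀ i j, 0 ≤ W i j) {x0 δ : Fin (n + 2)} (hne : x0 ≠ δ)
    {F : Fin (n + 2) → ℝ} (hx0 : F x0 = 1) (hδ : F δ = 0) :
    ∫⁻ β, ENNReal.ofReal (nuDensity W 0 β) * ENNReal.ofReal (weff (Hmat W β)⁻¹ x0 δ) ≤
      ENNReal.ofReal (dirichletEnergy W F) := by
  induction n with
  | zero =>
    have henergy : dirichletEnergy W F = W x0 δ := by
      have h10 : W 1 0 = W 0 1 := hW.apply 0 1
      fin_cases x0 <;> fin_cases δ <;> simp at hne hx0 hδ ⊢ <;>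
        simp [dirichletEnergy, Fin.sum_univ_two, hx0, hδ, h10] <;> ring
    calc _ ≤ ∫⁻ β, ENNReal.ofReal (nuDensity W 0 β) * ENNReal.ofReal (W x0 δ) := by
          refine lintegral_mono fun β => ?_
          by_cases hH : (Hmat W β).PosDef
          · rw [weff_Hmat_fin_two hW hne hH]
          · simp [nuDensity, hH]
      _ ≤ 1 * ENNReal.ofReal (W x0 δ) := by
          rw [lintegral_mul_const' _ _ ENNReal.ofReal_ne_top]
          gcongr
          exact lintegral_nuDensity_le_one hW hnonneg
      _ = _ := by rw [one_mul, henergy]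
  | succ n ih =>
    obtain ⟨p, hpx, hpδ⟩ := Fin.exists_ne_and_ne_of_two_lt x0 δ (by lia)
    obtain ⟨x, rfl⟩ := Fin.exists_succAbove_eq hpx.symm
    obtain ⟨d, rfl⟩ := Fin.exists_succAbove_eq hpδ.symm
    refine (lintegral_nuDensity_mul_le hW p _
      (fun t b => ENNReal.ofReal (weff (Hmat (starMesh W p (2 * t - W p p)) b)⁻¹ x d))
      fun t b hH => by rw [weff_inv_Hmat_insertNth hH]).trans ?_
    set s := ∑ j, W p (p.succAbove j)
    set w : Fin (n + 2) → ℝ := fun j => W p (p.succAbove j)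
    have hs0 : 0 ≤ s := Finset.sum_nonneg fun j _ => hnonneg _ _
    calc _ ≤ ∫⁻ t, ENNReal.ofReal (vertexKernel s (2 * t - W p p)) * ENNReal.ofReal
          (dirichletEnergy (W.submatrix p.succAbove p.succAbove) (F ∘ p.succAbove) +
            dirichletEnergy (fun j k => w j * w k) (F ∘ p.succAbove) / (2 * t - W p p)) := by
          refine lintegral_mono fun t => ?_
          rcases le_or_gt (2 * t - W p p) 0 with ht | ht
          · simp [vertexKernel_of_nonpos _ ht]
          · dsimp only
            gcongr
            rw [← dirichletEnergy_starMesh]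
            exact ih (starMesh_isSymm hW p _) (starMesh_nonneg hnonneg p ht.le)
              (fun h => hne (by rw [h])) hx0 hδ
      _ ≤ ENNReal.ofReal (dirichletEnergy (W.submatrix p.succAbove p.succAbove)
            (F ∘ p.succAbove) + dirichletEnergy (fun j k => w j * w k) (F ∘ p.succAbove) / s) := by
          refine lintegral_vertexKernel_mul_ofReal_le hs0
            (dirichletEnergy_nonneg (fun _ _ => hnonneg _ _) _)
            (dirichletEnergy_nonneg (fun _ _ => mul_nonneg (hnonneg _ _) (hnonneg _ _)) _)
            (fun h => ?_) _
          have hw : ∀ j, W p (p.succAbove j) = 0 := fun j =>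
            (Finset.sum_eq_zero_iff_of_nonneg fun j _ => hnonneg _ _).mp h j (Finset.mem_univ j)
          simp [dirichletEnergy, hw]
      _ ≤ _ := by
          rw [← dirichletEnergy_starMesh]
          exact ENNReal.ofReal_le_ofReal (dirichletEnergy_starMesh_sum_le hW hnonneg p F)

theorem measurable_nuDensity {n : ℕ} {W : Matrix (Fin n) (Fin n) ℝ} (hW : W.IsSymm) :
    Measurable (nuDensity W 0) := by
  have hentry (i j : Fin n) : Continuous fun β : Fin n → ℝ => Hmat W β i j := by
    unfold Hmat
    split_ifs <;> fun_prop
  have hcont : Continuous fun β : Fin n → ℝ => Hmat W β := continuous_matrix hentry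
  have hset : {β : Fin n → ℝ | (Hmat W β).PosDef} =
      (⋂ x : Fin n → ℝ, {β | 0 ≤ x ⬝ᵥ (Hmat W β *ᵥ x)}) ∩ {β | (Hmat W β).det ≠ 0} := by
    ext β
    simp only [Set.mem_ofPred_eq, Set.mem_inter_iff, Set.mem_iInter]
    constructor
    · exact fun h => ⟨fun x => h.posSemidef.dotProduct_mulVec_nonneg x, h.det_pos.ne'⟩
    · rintro ⟨h, hdet⟩
      exact (PosSemidef.posDef_iff_det_ne_zero (PosSemidef.of_dotProduct_mulVec_nonneg
        (Hmat_isSymm hW β) h)).mpr hdet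
  refine Measurable.ite ?_ ?_ measurable_const
  · rw [hset]
    refine (isClosed_iInter fun x => isClosed_le continuous_const
      (by fun_prop)).measurableSet.inter ?_
    exact (isOpen_ne_fun hcont.matrix_det continuous_const).measurableSet
  · have hdet : Measurable fun β => (Hmat W β).det := hcont.matrix_det.measurable
    have hsum : Measurable fun β => ∑ i, ∑ j, Hmat W β i j :=
      (continuous_finsetSum _ fun i _ => continuous_finsetSum _ fun j _ =>
        hentry i j).measurable
    simp only [zero_dotProduct]
    fun_prop

theorem integral_weff_le_dirichletEnergy {n : ℕ} {W : Matrix (Fin n) (Fin n) ℝ}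
    (hW : W.IsSymm) (hnonneg : ∀ i j, 0 ≤ W i j) {x0 δ : Fin n} (hne : x0 ≠ δ)
    {F : Fin n → ℝ} (hx0 : F x0 = 1) (hδ : F δ = 0) :
    ∫ β, weff (Hmat W β)⁻¹ x0 δ ∂(nuMeasure W 0) ≤ dirichletEnergy W F := by
  obtain ⟨m, rfl⟩ : ∃ m, n = m + 2 := by
    have := x0.isLt
    have := δ.isLt
    have := Fin.val_ne_of_ne hne
    exact ⟨n - 2, by lia⟩
  have hE := dirichletEnergy_nonneg hnonneg F
  by_cases hint : Integrable (fun β => weff (Hmat W β)⁻¹ x0 δ) (nuMeasure W 0)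
  · rw [integral_eq_lintegral_pos_part_sub_lintegral_neg_part hint]
    refine (sub_le_self _ ENNReal.toReal_nonneg).trans
      (ENNReal.toReal_le_of_le_ofReal hE ?_)
    exact (lintegral_withDensity_le_lintegral_mul _ (measurable_nuDensity hW).ennreal_ofReal
      _).trans (lintegral_weff_le_dirichletEnergy hW hnonneg hne hx0 hδ)
  · rwa [integral_undef hint]

/-- the mean effective weight of the VRJP with random weights is
bounded by the effective conductance of the averaged conductances. -/
theorem stmt17 {n : ℕ} (G : SimpleGraph (Fin n)) [DecidableRel G.Adj]
    (x0 δ : Fin n) (hx0δ : x0 ≠ δ)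
    (ρ : Measure (Matrix (Fin n) (Fin n) ℝ)) [IsProbabilityMeasure ρ]
    (hsymm : ∀ᵐ W ∂ρ, W.IsSymm)
    (hpos : ∀ᵐ W ∂ρ, ∀ x y, (G.Adj x y → 0 < W x y) ∧ (¬ G.Adj x y → W x y = 0))
    (hint : ∀ x y : Fin n, Integrable (fun W : Matrix (Fin n) (Fin n) ℝ => W x y) ρ) :
    (∫ W : Matrix (Fin n) (Fin n) ℝ,
        ∫ β : Fin n → ℝ, weff (Hmat W β)⁻¹ x0 δ ∂(nuMeasure W 0) ∂ρ) ≤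
      ceff G (fun x y => ∫ W : Matrix (Fin n) (Fin n) ℝ, W x y ∂ρ) x0 δ := by
  refine le_csInf (Set.Nonempty.image _ ⟨Pi.single x0 1, by simp [hx0δ.symm]⟩) ?_
  rintro _ ⟨F, ⟨hx0, hδ⟩, rfl⟩
  have hnonneg : ∀ᵐ W ∂ρ, ∀ x y, 0 ≤ W x y := by
    filter_upwards [hpos] with W hW x y
    by_cases h : G.Adj x y
    · exact ((hW x y).1 h).le
    · exact ((hW x y).2 h).ge
  have hterm (x y : Fin n) :
      (if G.Adj x y then (∫ W : Matrix (Fin n) (Fin n) ℝ, W x y ∂ρ) * (F x - F y) ^ 2 else 0) =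
        ∫ W : Matrix (Fin n) (Fin n) ℝ, W x y * (F x - F y) ^ 2 ∂ρ := by
    rw [integral_mul_const]
    split_ifs with h
    · rfl
    · rw [integral_eq_zero_of_ae (hpos.mono fun W hW => (hW x y).2 h), zero_mul]
  have hintegrable : Integrable (fun W => dirichletEnergy W F) ρ :=
    (integrable_finsetSum _ fun x _ => integrable_finsetSum _ fun y _ =>
      (hint x y).mul_const _).const_mul _
  have henergy : (1 / 2) * ∑ x, ∑ y, (if G.Adj x y then
      (∫ W : Matrix (Fin n) (Fin n) ℝ, W x y ∂ρ) * (F x - F y) ^ 2 else 0) =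
        ∫ W, dirichletEnergy W F ∂ρ := by
    simp only [hterm, dirichletEnergy]
    rw [integral_const_mul, integral_finsetSum _ fun x _ =>
      integrable_finsetSum _ fun y _ => (hint x y).mul_const _]
    congr 1
    exact Finset.sum_congr rfl fun x _ =>
      (integral_finsetSum _ fun y _ => (hint x y).mul_const _).symm
  refine le_of_le_of_eq ?_ henergy.symm
  by_cases hI : Integrable (fun W : Matrix (Fin n) (Fin n) ℝ =>
      ∫ β : Fin n → ℝ, weff (Hmat W β)⁻¹ x0 δ ∂(nuMeasure W 0)) ρ
  · refine integral_mono_ae hI hintegrable ?_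
    filter_upwards [hsymm, hnonneg] with W hW hW0
    exact integral_weff_le_dirichletEnergy hW hW0 hx0δ hx0 hδ
  · rw [integral_undef hI]
    exact integral_nonneg_of_ae (hnonneg.mono fun W hW => dirichletEnergy_nonneg hW F)
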